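/- arXiv:0711.1747 — 3 statements merged into one kernel-verified Lean document; each statement's English description precedes it below -/
import Mathlib

section
/- Let G ∈ 𝒢_𝒫 with parameters β_{ℓt}, α_{ℓt}, δ_{ℓt}, γ_{ℓt} as in the construction. Define n×n integer matrices E_1, E_2, E_3, E_4 as follows. E_1 has (i,i)-entry 1 for 1 ≤ i ≤ n; for 1 ≤ ℓ ≤ r_0 it has (ℓ, r_0+t)-entry −β_{d_ℓ t} for 1 ≤ t ≤ r_1, (ℓ, r_0+r_1+t)-entry −α_{d_ℓ t} − p·δ_{d_ℓ t} for 1 ≤ t ≤ r_2, (ℓ, r_0+r_1+r_2+t)-entry −γ_{d_ℓ t} for 1 ≤ t ≤ n-j, and all other entries 0. E_2 has (i,i)-entry 1 for 1 ≤ i ≤ n; for 1 ≤ ℓ ≤ n-j it has (r_0+r_1+r_2+ℓ, r_0+t)-entry −β_{c_ℓ t} for 1 ≤ t ≤ r_1, (r_0+r_1+r_2+ℓ, r_0+r_1+t)-entry −α_{c_ℓ t} for 1 ≤ t ≤ r_2, and zeros elsewhere. E_3 has (i,i)-entry 1 for 1 ≤ i ≤ n; for 1 ≤ ℓ ≤ r_1,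 1 ≤ t ≤ r_2 it has (r_0+ℓ, r_0+r_1+t)-entry −α_{b_ℓ t}, and zeros elsewhere. E_4 is the permutation matrix with 1 in entry (ℓ, d_ℓ) for 1 ≤ ℓ ≤ r_0, in entry (r_0+ℓ, b_ℓ) for 1 ≤ ℓ ≤ r_1, in entry (r_0+r_1+ℓ, a_ℓ) for 1 ≤ ℓ ≤ r_2, and in entry (r_0+r_1+r_2+ℓ, c_ℓ) for 1 ≤ ℓ ≤ n-j, and zeros elsewhere. Then G·E_1·E_2·E_3·E_4 = I_n; that is, G^{-1} = E_1·E_2·E_3·E_4. -/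
noncomputable section
open Matrix Pointwise

/-- `f` restricted to `{0, …, m-1}` is injective. -/
def InjOnLt (n : ℕ) (f : ℕ → Fin n) (m : ℕ) : Prop :=
  ∀ s, s < m → ∀ t, t < m → f s = f t → s = t

/-- The symplectic form matrix `J = [[0, I],[-I, 0]]`. -/
def Jmat (n : ℕ) : Matrix (Fin n ⊕ Fin n) (Fin n ⊕ Fin n) ℚ :=
  Matrix.fromBlocks 0 1 (-1) 0

/-- `Γ = Sp_n(ℤ)`, viewed as the set of integral rational matrices `γ` with `γᵀJγ = J`. -/
def SpGammaZ (n : ℕ) : Set (Matrix (Fin n ⊕ Fin n) (Fin n ⊕ Fin n) ℚ) :=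
  {g | (∀ i k, ∃ z : ℤ, g i k = (z : ℚ)) ∧ gᵀ * Jmat n * g = Jmat n}

/-- `Λ = ℤⁿ` as a `ℤ`-submodule of `ℚⁿ`. -/
def intLattice (n : ℕ) : Submodule ℤ (Fin n → ℚ) :=
  Submodule.span ℤ (Set.range fun i : Fin n => (Pi.single i 1 : Fin n → ℚ))

/-- The matrix `M = [[D, Y],[0, D⁻¹]] · [[G⁻¹, 0],[0, Gᵀ]]` (over `ℚ`). -/
def MmatQ (n : ℕ) (D : Matrix (Fin n) (Fin n) ℚ) (Y G : Matrix (Fin n) (Fin n) ℤ) :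
    Matrix (Fin n ⊕ Fin n) (Fin n ⊕ Fin n) ℚ :=
  Matrix.fromBlocks D (Y.map (Int.cast : ℤ → ℚ)) 0 D⁻¹ *
    Matrix.fromBlocks ((G.map (Int.cast : ℤ → ℚ))⁻¹) 0 0 ((G.map (Int.cast : ℤ → ℚ))ᵀ)
/-- An ordered partition `({d_t}, {b_t}, {a_t}, {c_t})` of `{1,…,n}` into pieces
of sizes `r0, r1, r2, r3`. -/
def GPPartition (n r0 r1 r2 r3 : ℕ) (d b a c : ℕ → Fin n) : Prop :=
  InjOnLt n d r0 ∧ InjOnLt n b r1 ∧ InjOnLt n a r2 ∧ InjOnLt n c r3 ∧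
  (∀ s, s < r0 → ∀ t, t < r1 → d s ≠ b t) ∧
  (∀ s, s < r0 → ∀ t, t < r2 → d s ≠ a t) ∧
  (∀ s, s < r0 → ∀ t, t < r3 → d s ≠ c t) ∧
  (∀ s, s < r1 → ∀ t, t < r2 → b s ≠ a t) ∧
  (∀ s, s < r1 → ∀ t, t < r3 → b s ≠ c t) ∧
  (∀ s, s < r2 → ∀ t, t < r3 → a s ≠ c t) ∧
  (∀ ℓ : Fin n, (∃ t, t < r0 ∧ d t = ℓ) ∨ (∃ t, t < r1 ∧ b t = ℓ) ∨
    (∃ t, t < r2 ∧ a t = ℓ) ∨ (∃ t, t < r3 ∧ c t = ℓ))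

/-- Admissibility of the entries `β_{ℓt}` of the block `G_1`. -/
def BetaValid (p n r1 r2 : ℕ) (b a : ℕ → Fin n) (β : Fin n → ℕ → ℤ) : Prop :=
  ∀ ℓ : Fin n, ∀ t, t < r1 →
    (ℓ = b t → β ℓ t = 1) ∧
    (((ℓ : ℕ) < (b t : ℕ) ∨ (∃ i, i < r2 ∧ a i = ℓ) ∨
        (∃ i, i < r1 ∧ i ≠ t ∧ b i = ℓ)) → β ℓ t = 0) ∧
    (0 ≤ β ℓ t ∧ β ℓ t < (p : ℤ))

/-- Admissibility of the entries `α_{ℓt}` of the block `G_2'`. -/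
def AlphaValid (p n r2 : ℕ) (a : ℕ → Fin n) (α : Fin n → ℕ → ℤ) : Prop :=
  ∀ ℓ : Fin n, ∀ t, t < r2 →
    (ℓ = a t → α ℓ t = 1) ∧
    (((ℓ : ℕ) < (a t : ℕ) ∨ (∃ i, i < r2 ∧ i ≠ t ∧ a i = ℓ)) → α ℓ t = 0) ∧
    (0 ≤ α ℓ t ∧ α ℓ t < (p : ℤ))

/-- Admissibility of the entries `δ_{ℓt}` of the block `G_2''`. -/
def DeltaValid (p n r0 r2 : ℕ) (d : ℕ → Fin n) (δ : Fin n → ℕ → ℤ) : Prop :=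
  ∀ ℓ : Fin n, ∀ t, t < r2 →
    ((¬ ∃ i, i < r0 ∧ d i = ℓ) → δ ℓ t = 0) ∧
    (0 ≤ δ ℓ t ∧ δ ℓ t < (p : ℤ))

/-- Admissibility of the entries `γ_{ℓt}` of the block `G_3`. -/
def GammaValid (p n r1 r2 r3 : ℕ) (b a c : ℕ → Fin n) (γ : Fin n → ℕ → ℤ) : Prop :=
  ∀ ℓ : Fin n, ∀ t, t < r3 →
    (ℓ = c t → γ ℓ t = 1) ∧
    (((ℓ : ℕ) < (c t : ℕ) ∨ (∃ i, i < r2 ∧ a i = ℓ) ∨ (∃ i, i < r1 ∧ b i = ℓ) ∨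
        (∃ i, i < r3 ∧ i ≠ t ∧ c i = ℓ)) → γ ℓ t = 0) ∧
    (0 ≤ γ ℓ t ∧ γ ℓ t < (p : ℤ))

/-- The matrix `G = (G_0, G_1, G_2' + p·G_2'', G_3)` in block-column form. -/
def GPBuild (p n r0 r1 r2 : ℕ) (d : ℕ → Fin n) (β α δ γ : Fin n → ℕ → ℤ) :
    Matrix (Fin n) (Fin n) ℤ :=
  Matrix.of fun ℓ k =>
    if (k : ℕ) < r0 then (if ℓ = d (k : ℕ) then 1 else 0)
    else if (k : ℕ) < r0 + r1 then β ℓ ((k : ℕ) - r0)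
    else if (k : ℕ) < r0 + r1 + r2 then
      α ℓ ((k : ℕ) - r0 - r1) + (p : ℤ) * δ ℓ ((k : ℕ) - r0 - r1)
    else γ ℓ ((k : ℕ) - r0 - r1 - r2)

/-- Membership in `𝒢_{r0,r2}` (with `r1 = j - r0 - r2` and `r3 = n - j`). -/
def GPMem (p n j r0 r2 : ℕ) (G : Matrix (Fin n) (Fin n) ℤ) : Prop :=
  ∃ d b a c β α δ γ,
    GPPartition n r0 (j - r0 - r2) r2 (n - j) d b a c ∧
    BetaValid p n (j - r0 - r2) r2 b a β ∧
    AlphaValid p n r2 a α ∧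
    DeltaValid p n r0 r2 d δ ∧
    GammaValid p n (j - r0 - r2) r2 (n - j) b a c γ ∧
    G = GPBuild p n r0 (j - r0 - r2) r2 d β α δ γ
/-- The matrix `E_1`. -/
def E1mat (p n j r0 r2 : ℕ) (d : ℕ → Fin n) (β α δ γ : Fin n → ℕ → ℤ) :
    Matrix (Fin n) (Fin n) ℤ :=
  Matrix.of fun i k =>
    if i = k then 1
    else if (i : ℕ) < r0 then
      (if (k : ℕ) < r0 then 0
       else if (k : ℕ) < r0 + (j - r0 - r2) then - β (d (i : ℕ)) ((k : ℕ) - r0)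
       else if (k : ℕ) < j then
         - α (d (i : ℕ)) ((k : ℕ) - r0 - (j - r0 - r2))
           - (p : ℤ) * δ (d (i : ℕ)) ((k : ℕ) - r0 - (j - r0 - r2))
       else - γ (d (i : ℕ)) ((k : ℕ) - j))
    else 0

/-- The matrix `E_2`. -/
def E2mat (n j r0 r2 : ℕ) (c : ℕ → Fin n) (β α : Fin n → ℕ → ℤ) :
    Matrix (Fin n) (Fin n) ℤ :=
  Matrix.of fun i k =>
    if i = k then 1
    else if j ≤ (i : ℕ) then
      (if r0 ≤ (k : ℕ) ∧ (k : ℕ) < r0 + (j - r0 - r2) then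
         - β (c ((i : ℕ) - j)) ((k : ℕ) - r0)
       else if r0 + (j - r0 - r2) ≤ (k : ℕ) ∧ (k : ℕ) < j then
         - α (c ((i : ℕ) - j)) ((k : ℕ) - r0 - (j - r0 - r2))
       else 0)
    else 0

/-- The matrix `E_3`. -/
def E3mat (n j r0 r2 : ℕ) (b : ℕ → Fin n) (α : Fin n → ℕ → ℤ) :
    Matrix (Fin n) (Fin n) ℤ :=
  Matrix.of fun i k =>
    if i = k then 1
    else if r0 ≤ (i : ℕ) ∧ (i : ℕ) < r0 + (j - r0 - r2) ∧
        r0 + (j - r0 - r2) ≤ (k : ℕ) ∧ (k : ℕ) < j then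
      - α (b ((i : ℕ) - r0)) ((k : ℕ) - r0 - (j - r0 - r2))
    else 0

/-- The permutation matrix `E_4`. -/
def E4mat (n j r0 r2 : ℕ) (d b a c : ℕ → Fin n) : Matrix (Fin n) (Fin n) ℤ :=
  Matrix.of fun i k =>
    if ((i : ℕ) < r0 ∧ k = d (i : ℕ)) ∨
       (r0 ≤ (i : ℕ) ∧ (i : ℕ) < r0 + (j - r0 - r2) ∧ k = b ((i : ℕ) - r0)) ∨
       (r0 + (j - r0 - r2) ≤ (i : ℕ) ∧ (i : ℕ) < j ∧
         k = a ((i : ℕ) - r0 - (j - r0 - r2))) ∨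
       (j ≤ (i : ℕ) ∧ k = c ((i : ℕ) - j)) then 1 else 0

/-- The row indexing `(d, b, a, c)`. -/
def gpSigma (n j r0 r2 : ℕ) (d b a c : ℕ → Fin n) (i : Fin n) : Fin n :=
  if (i : ℕ) < r0 then d i
  else if (i : ℕ) < r0 + (j - r0 - r2) then b ((i : ℕ) - r0)
  else if (i : ℕ) < j then a ((i : ℕ) - r0 - (j - r0 - r2))
  else c ((i : ℕ) - j)

theorem gp_E4_apply (n j r0 r2 : ℕ) (hr : r0 + r2 ≤ j) (d b a c : ℕ → Fin n) (i k : Fin n) :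
    E4mat n j r0 r2 d b a c i k = if k = gpSigma n j r0 r2 d b a c i then 1 else 0 := by
  simp only [E4mat, gpSigma, Matrix.of_apply]
  congr 1
  apply propext
  split_ifs <;> grind

theorem gp_E4_mul (n j r0 r2 : ℕ) (hr : r0 + r2 ≤ j) (d b a c : ℕ → Fin n)
    (G : Matrix (Fin n) (Fin n) ℤ) (i k : Fin n) :
    (E4mat n j r0 r2 d b a c * G) i k = G (gpSigma n j r0 r2 d b a c i) k := by
  simp [Matrix.mul_apply, gp_E4_apply n j r0 r2 hr]

theorem gp_mul_zero_of_support {n : ℕ} (A B : Matrix (Fin n) (Fin n) ℤ)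
    (h : ∀ i m k, A i m = 0 ∨ B m k = 0) : A * B = 0 := by
  ext i k
  rw [Matrix.mul_apply, Matrix.zero_apply]
  exact Finset.sum_eq_zero fun m _ => mul_eq_zero.2 (h i m k)

theorem gp_E4_mul_build (p n j r0 r2 : ℕ) (hjn : j ≤ n)
    (hr : r0 + r2 ≤ j)
    (d b a c : ℕ → Fin n) (β α δ γ : Fin n → ℕ → ℤ)
    (hpart : GPPartition n r0 (j - r0 - r2) r2 (n - j) d b a c)
    (hβ : BetaValid p n (j - r0 - r2) r2 b a β)
    (hα : AlphaValid p n r2 a α)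
    (hδ : DeltaValid p n r0 r2 d δ)
    (hγ : GammaValid p n (j - r0 - r2) r2 (n - j) b a c γ) :
    E4mat n j r0 r2 d b a c * GPBuild p n r0 (j - r0 - r2) r2 d β α δ γ =
      1 - (E1mat p n j r0 r2 d β α δ γ - 1) - (E2mat n j r0 r2 c β α - 1)
        - (E3mat n j r0 r2 b α - 1) := by
  unfold GPPartition InjOnLt at hpart
  obtain ⟨id, ib, ia, ic, hdb, hda, hdc, hba, hbc, hac, -⟩ := hpart
  obtain ⟨r1, hr1⟩ : ∃ r1, r1 = j - r0 - r2 := ⟨_, rfl⟩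
  rw [← hr1] at hβ hγ ib hdb hba hbc
  have hj : j = r0 + r1 + r2 := by omega
  ext i k
  rw [gp_E4_mul n j r0 r2 hr]
  have hi := i.2
  have hk := k.2
  have hik : i = k ↔ (i : ℕ) = k := Fin.ext_iff
  have e3 : (k : ℕ) - r0 - r1 - r2 = k - j := by omega
  have hδ0 : ∀ l t, t < r2 → (∀ s, s < r0 → d s ≠ l) → δ l t = 0 := fun l t ht h =>
    (hδ l t ht).1 (fun ⟨s, hs, e⟩ => h s hs e)
  have hβ' := fun l t ht => (hβ l t ht).1
  have hβ0 := fun l t ht => (hβ l t ht).2.1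
  have hα' := fun l t ht => (hα l t ht).1
  have hα0 := fun l t ht => (hα l t ht).2.1
  have hγ' := fun l t ht => (hγ l t ht).1
  have hγ0 := fun l t ht => (hγ l t ht).2.1
  clear hβ hα hγ hδ
  simp only [Matrix.sub_apply, Matrix.one_apply, E1mat, E2mat, E3mat, GPBuild, gpSigma,
    Matrix.of_apply, ← hr1, e3, ← hj, hik]
  generalize (i : ℕ) = x at *
  generalize (k : ℕ) = y at *
  rcases lt_or_ge x r0 with h1 | h1
  · rcases lt_or_ge y r0 with h2 | h2
    · grind
    · grind
  rcases lt_or_ge x (r0 + r1) with h3 | h3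
  · rcases lt_or_ge y r0 with h2 | h2
    · grind
    rcases lt_or_ge y (r0 + r1) with h2 | h2
    · grind
    rcases lt_or_ge y j with h2 | h2
    · grind
    · grind
  rcases lt_or_ge x j with h4 | h4
  · rcases lt_or_ge y r0 with h2 | h2
    · grind
    rcases lt_or_ge y (r0 + r1) with h2 | h2
    · grind
    rcases lt_or_ge y j with h2 | h2
    · grind
    · grind
  · rcases lt_or_ge y r0 with h2 | h2
    · grind
    rcases lt_or_ge y (r0 + r1) with h2 | h2
    · grind
    rcases lt_or_ge y j with h2 | h2
    · grind
    · grind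

/-- **The explicit inverse of `G ∈ 𝒢_𝒫`:** `G·E_1·E_2·E_3·E_4 = I`,
i.e. `G⁻¹ = E_1·E_2·E_3·E_4`. -/
theorem gp_mul_E1_E2_E3_E4_eq_one
    (p n j r0 r2 : ℕ) (hp : p.Prime) (hn : 1 ≤ n) (hj1 : 1 ≤ j) (hjn : j ≤ n)
    (hr : r0 + r2 ≤ j)
    (d b a c : ℕ → Fin n) (β α δ γ : Fin n → ℕ → ℤ)
    (hpart : GPPartition n r0 (j - r0 - r2) r2 (n - j) d b a c)
    (hβ : BetaValid p n (j - r0 - r2) r2 b a β)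
    (hα : AlphaValid p n r2 a α)
    (hδ : DeltaValid p n r0 r2 d δ)
    (hγ : GammaValid p n (j - r0 - r2) r2 (n - j) b a c γ) :
    GPBuild p n r0 (j - r0 - r2) r2 d β α δ γ *
      E1mat p n j r0 r2 d β α δ γ * E2mat n j r0 r2 c β α *
      E3mat n j r0 r2 b α * E4mat n j r0 r2 d b a c = 1 := by
  have hH := gp_E4_mul_build p n j r0 r2 hjn hr d b a c β α δ γ hpart hβ hα hδ hγ
  have e1 : E1mat p n j r0 r2 d β α δ γ = 1 + (E1mat p n j r0 r2 d β α δ γ - 1) := by abel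
  have e2 : E2mat n j r0 r2 c β α = 1 + (E2mat n j r0 r2 c β α - 1) := by abel
  have e3 : E3mat n j r0 r2 b α = 1 + (E3mat n j r0 r2 b α - 1) := by abel
  have s1 : ∀ i k : Fin n, ¬ ((i : ℕ) < r0 ∧ r0 ≤ (k : ℕ)) →
      (E1mat p n j r0 r2 d β α δ γ - 1) i k = 0 := by
    intro i k h
    simp only [Matrix.sub_apply, Matrix.one_apply, E1mat, Matrix.of_apply]
    split_ifs <;> grind
  have s2 : ∀ i k : Fin n, ¬ (j ≤ (i : ℕ) ∧ r0 ≤ (k : ℕ) ∧ (k : ℕ) < j) →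
      (E2mat n j r0 r2 c β α - 1) i k = 0 := by
    intro i k h
    simp only [Matrix.sub_apply, Matrix.one_apply, E2mat, Matrix.of_apply]
    split_ifs <;> grind
  have s3 : ∀ i k : Fin n, ¬ (r0 ≤ (i : ℕ) ∧ (i : ℕ) < r0 + (j - r0 - r2) ∧
      r0 + (j - r0 - r2) ≤ (k : ℕ) ∧ (k : ℕ) < j) →
      (E3mat n j r0 r2 b α - 1) i k = 0 := by
    intro i k h
    simp only [Matrix.sub_apply, Matrix.one_apply, E3mat, Matrix.of_apply]
    split_ifs <;> grind
  rw [mul_eq_one_comm]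
  simp only [← Matrix.mul_assoc]
  rw [hH]
  generalize E1mat p n j r0 r2 d β α δ γ - 1 = N1 at *
  generalize E2mat n j r0 r2 c β α - 1 = N2 at *
  generalize E3mat n j r0 r2 b α - 1 = N3 at *
  rw [e1, e2, e3]
  have z11 : N1 * N1 = 0 := gp_mul_zero_of_support _ _ fun i m k => by grind
  have z21 : N2 * N1 = 0 := gp_mul_zero_of_support _ _ fun i m k => by grind
  have z31 : N3 * N1 = 0 := gp_mul_zero_of_support _ _ fun i m k => by grind
  have z22 : N2 * N2 = 0 := gp_mul_zero_of_support _ _ fun i m k => by grind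
  have z32 : N3 * N2 = 0 := gp_mul_zero_of_support _ _ fun i m k => by grind
  have z33 : N3 * N3 = 0 := gp_mul_zero_of_support _ _ fun i m k => by grind
  have t1 : (1 - N1 - N2 - N3) * (1 + N1) = 1 - N2 - N3 := by
    simp only [mul_add, sub_mul, z11, z21, z31, one_mul, mul_one]; abel
  have t2 : (1 - N2 - N3) * (1 + N2) = 1 - N3 := by
    simp only [mul_add, sub_mul, z22, z32, one_mul, mul_one]; abel
  have t3 : (1 - N3) * (1 + N3) = 1 := by
    simp only [mul_add, sub_mul, z33, one_mul, mul_one]; abel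
  rw [t1, t2, t3]
end
end

section
/- Let Λ = ℤⁿ regarded as a ℤ-submodule of ℚⁿ. For every G ∈ 𝒢_{r_0,r_2}, the columns of the rational matrix G·diag(p·I_{r_0}, I_{r_1}, p^{-1}·I_{r_2}, I_{n-j}) form a ℤ-basis of the ℤ-submodule Ω_G of ℚⁿ that they generate; moreover pΛ ⊆ Ω_G ⊆ p^{-1}Λ, dim_{𝔽_p} Λ/(Λ ∩ Ω_G) = r_0, and dim_{𝔽_p} (Λ + Ω_G)/Λ = r_2. -/
noncomputable section
open Matrix Pointwise

/-- The diagonal entries of `diag(p·I_{r0}, I_{r1}, p⁻¹·I_{r2}, I_{n-j})`. -/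
def DScale (p n j r0 r2 : ℕ) (k : Fin n) : ℚ :=
  if (k : ℕ) < r0 then (p : ℚ)
  else if (k : ℕ) < r0 + (j - r0 - r2) then 1
  else if (k : ℕ) < j then (p : ℚ)⁻¹
  else 1

/-- `Ω_G`: the `ℤ`-span of the columns of `G·diag(p·I_{r0}, I_{r1}, p⁻¹·I_{r2}, I_{n-j})`. -/
def OmegaQ (p n j r0 r2 : ℕ) (G : Matrix (Fin n) (Fin n) ℤ) :
    Submodule ℤ (Fin n → ℚ) :=
  Submodule.span ℤ
    (Set.range fun k : Fin n => fun i : Fin n => (G i k : ℚ) * DScale p n j r0 r2 k)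
lemma aux_span {n : ℕ} (G : Matrix (Fin n) (Fin n) ℤ) (σ : Fin n → Fin n) (ρ : Fin n → ℕ)
    (hσ : Function.Surjective σ) (h1 : ∀ k, G (σ k) k = 1)
    (h2 : ∀ k k', k' ≠ k → G (σ k') k = 0 ∨ ρ k' < ρ k) :
    Submodule.span ℤ (Set.range fun k : Fin n => fun i : Fin n => (G i k : ℚ)) =
      intLattice n := by
  apply le_antisymm
  · rw [Submodule.span_le]
    rintro _ ⟨k, rfl⟩
    have : (fun i : Fin n => (G i k : ℚ)) = ∑ l, (G l k) • (Pi.single l 1 : Fin n → ℚ) := by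
      ext i
      simp [Finset.sum_apply, Pi.single_apply]
    change (fun i : Fin n => (G i k : ℚ)) ∈ intLattice n
    rw [this]
    exact Submodule.sum_mem _ fun l _ => Submodule.smul_mem _ _ (Submodule.subset_span ⟨l, rfl⟩)
  · unfold intLattice
    rw [Submodule.span_le]
    rintro _ ⟨l, rfl⟩
    obtain ⟨k, rfl⟩ := hσ l
    have key : ∀ m k, ρ k = m → (Pi.single (σ k) 1 : Fin n → ℚ) ∈ 
        Submodule.span ℤ (Set.range fun k : Fin n => fun i : Fin n => (G i k : ℚ)) := by
      intro m
      induction m using Nat.strong_induction_on with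
      | _ m ih =>
        intro k hk
        have : (Pi.single (σ k) 1 : Fin n → ℚ) = (fun i : Fin n => (G i k : ℚ)) -
            ∑ l ∈ Finset.univ.erase (σ k), (G l k) • (Pi.single l 1 : Fin n → ℚ) := by
          have : (fun i : Fin n => (G i k : ℚ)) = ∑ l, (G l k) • (Pi.single l 1 : Fin n → ℚ) := by
            ext i
            simp [Finset.sum_apply, Pi.single_apply]
          rw [this, ← Finset.add_sum_erase _ _ (Finset.mem_univ (σ k)), h1]
          simp
        rw [this]
        refine Submodule.sub_mem _ (Submodule.subset_span ⟨k, rfl⟩)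
          (Submodule.sum_mem _ fun l hl => ?_)
        obtain ⟨k', rfl⟩ := hσ l
        have hne : k' ≠ k := by
          rintro rfl
          simp at hl
        rcases h2 k k' hne with h | h
        · rw [h]; simp
        · exact Submodule.smul_mem _ _ (ih (ρ k') (hk ▸ h) k' rfl)
    exact key _ k rfl

lemma aux_mem {n : ℕ} (g : Fin n → Fin n → ℚ) (hg : LinearIndependent ℚ g) (s x : Fin n → ℚ) :
    (∑ k, x k • g k) ∈ Submodule.span ℤ (Set.range fun k => s k • g k) ↔
      ∀ k, ∃ z : ℤ, x k = z * s k := by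
  rw [Submodule.mem_span_range_iff_exists_fun]
  constructor
  · rintro ⟨c, hc⟩ k
    refine ⟨c k, ?_⟩
    have : ∑ k, (x k - c k * s k) • g k = 0 := by
      simp only [sub_smul, Finset.sum_sub_distrib, ← hc, mul_smul, Int.cast_smul_eq_zsmul,
        sub_self]
    have := Fintype.linearIndependent_iff.1 hg _ this k
    linarith
  · intro h
    choose c hc using h
    refine ⟨c, Finset.sum_congr rfl fun k _ => ?_⟩
    rw [hc, mul_smul, Int.cast_smul_eq_zsmul]

lemma aux_li {n : ℕ} (g : Fin n → Fin n → ℚ) (hg : LinearIndependent ℚ g) (s : Fin n → ℚ)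
    (hs : ∀ k, s k ≠ 0) : LinearIndependent ℤ (fun k => s k • g k) := by
  rw [Fintype.linearIndependent_iff]
  intro c hc k
  have : ∑ k, ((c k : ℚ) * s k) • g k = 0 := by
    rw [← hc]
    simp only [mul_smul, Int.cast_smul_eq_zsmul]
  have := Fintype.linearIndependent_iff.1 hg _ this k
  simpa [hs k] using this

lemma aux_card {n p : ℕ} (hp : p.Prime) (g : Fin n → Fin n → ℚ) (hg : LinearIndependent ℤ g)
    (M N : Submodule ℤ (Fin n → ℚ)) (hM : Submodule.span ℤ (Set.range g) = M) (S : Finset (Fin n))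
    (h : ∀ c : Fin n → ℤ, ∑ k, c k • g k ∈ N ↔ ∀ k ∈ S, (p : ℤ) ∣ c k) :
    Nat.card (M ⧸ N.comap M.subtype) = p ^ S.card := by
  subst hM
  have : NeZero p := ⟨hp.ne_zero⟩
  let B := Module.Basis.span hg
  let f : (Submodule.span ℤ (Set.range g)) →ₗ[ℤ] (S → ZMod p) :=
    { toFun := fun v k => ((B.repr v k : ℤ) : ZMod p)
      map_add' := by intro x y; ext k; simp
      map_smul' := by intro m x; ext k; simp }
  have hB : ∀ v : Submodule.span ℤ (Set.range g), (v : Fin n → ℚ) = ∑ k, B.repr v k • g k := by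
    intro v
    conv_lhs => rw [← B.sum_repr v]
    simp [B, Module.Basis.span_apply]
  have hker : LinearMap.ker f = N.comap (Submodule.span ℤ (Set.range g)).subtype := by
    ext v
    rw [LinearMap.mem_ker, Submodule.mem_comap, Submodule.subtype_apply, hB v, h]
    simp only [funext_iff, f, LinearMap.coe_mk, AddHom.coe_mk, Pi.zero_apply,
      ZMod.intCast_zmod_eq_zero_iff_dvd, Subtype.forall]
  have hsurj : Function.Surjective f := by
    intro y
    refine ⟨∑ k, (if hk : k ∈ S then ((y ⟨k, hk⟩).val : ℤ) else 0) • B k, ?_⟩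
    ext k
    simp only [f, LinearMap.coe_mk, AddHom.coe_mk, Module.Basis.repr_sum_self]
    simp
  rw [← hker, Nat.card_congr (f.quotKerEquivOfSurjective hsurj).toEquiv]
  simp

lemma aux_main (p n : ℕ) (hp : p.Prime) (G : Matrix (Fin n) (Fin n) ℤ)
    (hG : Submodule.span ℤ (Set.range fun k : Fin n => fun i : Fin n => (G i k : ℚ)) =
      intLattice n) (s : Fin n → ℚ) (S0 S2 : Finset (Fin n)) (hd : Disjoint S0 S2)
    (hs0 : ∀ k ∈ S0, s k = p) (hs2 : ∀ k ∈ S2, s k = (p : ℚ)⁻¹)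
    (hs1 : ∀ k, k ∉ S0 → k ∉ S2 → s k = 1) (Ω : Submodule ℤ (Fin n → ℚ))
    (hΩ : Ω = Submodule.span ℤ (Set.range fun k : Fin n => fun i : Fin n => (G i k : ℚ) * s k)) :
    LinearIndependent ℤ (fun k : Fin n => fun i : Fin n => (G i k : ℚ) * s k) ∧
    (∀ v ∈ intLattice n, (p : ℚ) • v ∈ Ω) ∧
    (∀ v ∈ Ω, (p : ℚ) • v ∈ intLattice n) ∧
    Nat.card (↥(intLattice n) ⧸
      ((intLattice n ⊓ Ω).comap (intLattice n).subtype)) = p ^ S0.card ∧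
    Nat.card (↥(intLattice n ⊔ Ω) ⧸
      ((intLattice n).comap (intLattice n ⊔ Ω).subtype)) = p ^ S2.card := by
  have hp0 : (p : ℚ) ≠ 0 := by exact_mod_cast hp.ne_zero
  set g : Fin n → Fin n → ℚ := fun k i => (G i k : ℚ) with hgdef
  have hcol : (fun k : Fin n => fun i : Fin n => (G i k : ℚ) * s k) = fun k => s k • g k := by
    ext k i
    simp [g, mul_comm]
  rw [hcol] at hΩ ⊢
  have hspan : ⊤ ≤ Submodule.span ℚ (Set.range g) := by
    have hle : ∀ v ∈ intLattice n, v ∈ Submodule.span ℚ (Set.range g) := by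
      intro v hv
      rw [← hG] at hv
      exact Submodule.span_le_restrictScalars ℤ ℚ _ hv
    rw [← (Pi.basisFun ℚ (Fin n)).span_eq, Submodule.span_le]
    rintro _ ⟨i, rfl⟩
    apply hle
    rw [Pi.basisFun_apply]
    exact Submodule.subset_span ⟨i, rfl⟩
  have hg : LinearIndependent ℚ g :=
    linearIndependent_of_top_le_span_of_card_eq_finrank hspan (by simp)
  have hex : ∀ v : Fin n → ℚ, ∃ x : Fin n → ℚ, v = ∑ k, x k • g k := by
    intro v
    have : v ∈ Submodule.span ℚ (Set.range g) := hspan trivial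
    obtain ⟨c, hc⟩ := (Submodule.mem_span_range_iff_exists_fun ℚ).1 this
    exact ⟨c, hc.symm⟩
  have hΛ : intLattice n = Submodule.span ℤ (Set.range fun k => (1 : ℚ) • g k) := by
    simp [← hG]
  have mΛ : ∀ x : Fin n → ℚ, ∑ k, x k • g k ∈ intLattice n ↔ ∀ k, ∃ z : ℤ, x k = z := by
    intro x
    rw [hΛ, aux_mem g hg (fun _ => 1)]
    simp
  have mΩ : ∀ x : Fin n → ℚ, ∑ k, x k • g k ∈ Ω ↔ ∀ k, ∃ z : ℤ, x k = z * s k := by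
    intro x
    rw [hΩ, aux_mem g hg s]
  have hcase : ∀ k, (k ∈ S0 ∧ k ∉ S2 ∧ s k = p) ∨ (k ∈ S2 ∧ k ∉ S0 ∧ s k = (p : ℚ)⁻¹) ∨
      (k ∉ S0 ∧ k ∉ S2 ∧ s k = 1) := by
    intro k
    by_cases h0 : k ∈ S0
    · exact Or.inl ⟨h0, Finset.disjoint_left.1 hd h0, hs0 k h0⟩
    · by_cases h2 : k ∈ S2
      · exact Or.inr (Or.inl ⟨h2, h0, hs2 k h2⟩)
      · exact Or.inr (Or.inr ⟨h0, h2, hs1 k h0 h2⟩)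
  have hsne : ∀ k, s k ≠ 0 := by
    intro k
    rcases hcase k with ⟨-, -, h⟩ | ⟨-, -, h⟩ | ⟨-, -, h⟩ <;> rw [h] <;> simp [hp0]
  refine ⟨aux_li g hg s hsne, ?_, ?_, ?_, ?_⟩
  · intro v hv
    obtain ⟨x, rfl⟩ := hex v
    rw [mΛ] at hv
    simp only [Finset.smul_sum, smul_smul]
    rw [mΩ fun k => p * x k]
    intro k
    obtain ⟨z, hz⟩ := hv k
    rcases hcase k with ⟨-, -, h⟩ | ⟨-, -, h⟩ | ⟨-, -, h⟩ <;> rw [h, hz]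
    · exact ⟨z, mul_comm _ _⟩
    · exact ⟨p * p * z, by push_cast; field_simp⟩
    · exact ⟨p * z, by push_cast; ring⟩
  · intro v hv
    obtain ⟨x, rfl⟩ := hex v
    rw [mΩ] at hv
    simp only [Finset.smul_sum, smul_smul]
    rw [mΛ fun k => p * x k]
    intro k
    obtain ⟨z, hz⟩ := hv k
    rcases hcase k with ⟨-, -, h⟩ | ⟨-, -, h⟩ | ⟨-, -, h⟩ <;> rw [hz, h]
    · exact ⟨p * p * z, by push_cast; ring⟩
    · exact ⟨z, by field_simp⟩
    · exact ⟨p * z, by push_cast; ring⟩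
  · apply aux_card hp g (by simpa using aux_li g hg (fun _ => 1) (by simp)) _ _ hG
    intro c
    have e : ∑ k, c k • g k = ∑ k, (c k : ℚ) • g k := by simp only [Int.cast_smul_eq_zsmul]
    rw [Submodule.mem_inf, e, mΛ (fun k => c k), mΩ (fun k => c k)]
    constructor
    · rintro ⟨-, h⟩ k hk
      obtain ⟨z, hz⟩ := h k
      rw [hs0 k hk] at hz
      exact ⟨z, by rw [mul_comm]; exact_mod_cast hz⟩
    · refine fun h => ⟨fun k => ⟨c k, rfl⟩, fun k => ?_⟩
      rcases hcase k with ⟨h0, -, hk⟩ | ⟨-, -, hk⟩ | ⟨-, -, hk⟩ <;> rw [hk]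
      · obtain ⟨z, hz⟩ := h k h0
        exact ⟨z, by rw [hz]; push_cast; ring⟩
      · exact ⟨p * c k, by push_cast; field_simp⟩
      · exact ⟨c k, by simp⟩
  · let E : Fin n → ℚ := fun k => if k ∈ S2 then (p : ℚ)⁻¹ else 1
    have hE : ∀ k, E k ≠ 0 := by
      intro k
      simp only [E]
      split_ifs <;> simp [hp0]
    have hsup : Submodule.span ℤ (Set.range fun k => E k • g k) = intLattice n ⊔ Ω := by
      have single : ∀ (k : Fin n) (t : ℚ), t • g k = ∑ k', (Pi.single k t : Fin n → ℚ) k' • g k' := by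
        intro k t
        simp [Pi.single_apply, ite_smul]
      apply le_antisymm
      · rw [Submodule.span_le]
        rintro _ ⟨k, rfl⟩
        by_cases hk : k ∈ S2
        · apply Submodule.mem_sup_right
          rw [hΩ]
          apply Submodule.subset_span
          exact ⟨k, by simp [E, hk, hs2 k hk]⟩
        · apply Submodule.mem_sup_left
          rw [hΛ]
          apply Submodule.subset_span
          exact ⟨k, by simp [E, hk]⟩
      · apply sup_le
        · intro v hv
          obtain ⟨x, rfl⟩ := hex v
          rw [mΛ] at hv
          rw [aux_mem g hg E]
          intro k
          obtain ⟨z, hz⟩ := hv k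
          by_cases hk : k ∈ S2
          · exact ⟨p * z, by simp only [E, hk, hz]; push_cast; field_simp⟩
          · exact ⟨z, by simp [E, hk, hz]⟩
        · intro v hv
          obtain ⟨x, rfl⟩ := hex v
          rw [mΩ] at hv
          rw [aux_mem g hg E]
          intro k
          obtain ⟨z, hz⟩ := hv k
          rcases hcase k with ⟨h0, h2, hk⟩ | ⟨h2, h0, hk⟩ | ⟨h0, h2, hk⟩ <;> rw [hz, hk]
          · exact ⟨z * p, by simp [E, h2]⟩
          · exact ⟨z, by simp [E, h2]⟩
          · exact ⟨z, by simp [E, h2]⟩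
    apply aux_card hp (fun k => E k • g k) (aux_li g hg E hE) _ _ hsup
    intro c
    have e : ∑ k, c k • E k • g k = ∑ k, ((c k : ℚ) * E k) • g k := by simp only [mul_smul, Int.cast_smul_eq_zsmul]
    rw [e, mΛ (fun k => c k * E k)]
    constructor
    · intro h k hk
      obtain ⟨z, hz⟩ := h k
      simp only [E, hk, if_true] at hz
      field_simp at hz
      exact ⟨z, by exact_mod_cast hz⟩
    · intro h k
      by_cases hk : k ∈ S2
      · obtain ⟨z, hz⟩ := h k hk
        exact ⟨z, by simp only [E, hk, if_true, hz]; push_cast; field_simp⟩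
      · exact ⟨c k, by simp [E, hk]⟩

lemma aux_G (p n j r0 r2 : ℕ) (hjn : j ≤ n)
    (hr : r0 + r2 ≤ j) (G : Matrix (Fin n) (Fin n) ℤ) (hG : GPMem p n j r0 r2 G) :
    Submodule.span ℤ (Set.range fun k : Fin n => fun i : Fin n => (G i k : ℚ)) =
      intLattice n := by
  obtain ⟨d, b, a, c, β, α, δ, γ, hP, hβ, hα, hδ, hγ, rfl⟩ := hG
  obtain ⟨r1, hr1⟩ : ∃ r1, r1 = j - r0 - r2 := ⟨_, rfl⟩
  obtain ⟨r3, hr3⟩ : ∃ r3, r3 = n - j := ⟨_, rfl⟩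
  rw [← hr1, ← hr3] at hP hγ
  rw [← hr1] at hβ ⊢
  obtain ⟨id, ib, ia, ic, hdb, hda, hdc, hba, hbc, hac, hcov⟩ := hP
  have hn : r0 + r1 + r2 + r3 = n := by omega
  clear hr1 hr3 hjn hr
  -- Column index type: block and position
  let σ : Fin n → Fin n := fun k =>
    if (k : ℕ) < r0 then d k else if (k : ℕ) < r0 + r1 then b (k - r0)
    else if (k : ℕ) < r0 + r1 + r2 then a (k - r0 - r1) else c (k - r0 - r1 - r2)
  let ρ : Fin n → ℕ := fun k =>
    if (k : ℕ) < r0 then 0 else if (k : ℕ) < r0 + r1 then 2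
    else if (k : ℕ) < r0 + r1 + r2 then 3 else 1
  have cases : ∀ k : Fin n,
      (∃ t, t < r0 ∧ (k : ℕ) = t ∧ σ k = d t ∧ ρ k = 0 ∧
        ∀ l, GPBuild p n r0 r1 r2 d β α δ γ l k = if l = d t then 1 else 0) ∨
      (∃ t, t < r1 ∧ (k : ℕ) = r0 + t ∧ σ k = b t ∧ ρ k = 2 ∧
        ∀ l, GPBuild p n r0 r1 r2 d β α δ γ l k = β l t) ∨
      (∃ t, t < r2 ∧ (k : ℕ) = r0 + r1 + t ∧ σ k = a t ∧ ρ k = 3 ∧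
        ∀ l, GPBuild p n r0 r1 r2 d β α δ γ l k = α l t + p * δ l t) ∨
      (∃ t, t < r3 ∧ (k : ℕ) = r0 + r1 + r2 + t ∧ σ k = c t ∧ ρ k = 1 ∧
        ∀ l, GPBuild p n r0 r1 r2 d β α δ γ l k = γ l t) := by
    intro k
    have hk := k.2
    simp only [σ, ρ, GPBuild, Matrix.of_apply]
    by_cases h0 : (k : ℕ) < r0
    · left
      exact ⟨k, h0, rfl, by simp [h0], by simp [h0], by simp [h0]⟩
    right
    by_cases h1 : (k : ℕ) < r0 + r1
    · left
      exact ⟨k - r0, by omega, by omega, by simp [h0, h1], by simp [h0, h1], by simp [h0, h1]⟩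
    right
    by_cases h2 : (k : ℕ) < r0 + r1 + r2
    · left
      exact ⟨k - r0 - r1, by omega, by omega, by simp [h0, h1, h2], by simp [h0, h1, h2],
        by simp [h0, h1, h2]⟩
    right
    exact ⟨k - r0 - r1 - r2, by omega, by omega, by simp [h0, h1, h2], by simp [h0, h1, h2],
        by simp [h0, h1, h2]⟩
  apply aux_span _ σ ρ
  · intro l
    rcases hcov l with ⟨t, ht, h⟩ | ⟨t, ht, h⟩ | ⟨t, ht, h⟩ | ⟨t, ht, h⟩
    · exact ⟨⟨t, by omega⟩, by simp [σ, ht, h]⟩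
    · exact ⟨⟨r0 + t, by omega⟩, by simp [σ, ht, h]⟩
    · refine ⟨⟨r0 + r1 + t, by omega⟩, ?_⟩
      have e1 : ¬ (r0 + r1 + t < r0) := by omega
      have e2 : ¬ (r0 + r1 + t < r0 + r1) := by omega
      have e3 : r0 + r1 + t < r0 + r1 + r2 := by omega
      have e4 : r0 + r1 + t - r0 - r1 = t := by omega
      simp only [σ, e1, e2, e3, e4, if_true, if_false, h]
    · refine ⟨⟨r0 + r1 + r2 + t, by omega⟩, ?_⟩
      have e1 : ¬ (r0 + r1 + r2 + t < r0) := by omega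
      have e2 : ¬ (r0 + r1 + r2 + t < r0 + r1) := by omega
      have e3 : ¬ (r0 + r1 + r2 + t < r0 + r1 + r2) := by omega
      have e4 : r0 + r1 + r2 + t - r0 - r1 - r2 = t := by omega
      simp only [σ, e1, e2, e3, e4, if_false, h]
  · intro k
    rcases cases k with ⟨t, ht, -, h, -, hh⟩ | ⟨t, ht, -, h, -, hh⟩ | ⟨t, ht, -, h, -, hh⟩ |
      ⟨t, ht, -, h, -, hh⟩ <;> rw [hh, h]
    · simp
    · exact (hβ _ t ht).1 rfl
    · rw [(hα _ t ht).1 rfl, (hδ _ t ht).1]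
      · simp
      · rintro ⟨i, hi, h⟩
        exact hda i hi t ht h
    · exact (hγ _ t ht).1 rfl
  · intro k k' hne
    have hne' : (k' : ℕ) ≠ k := fun h => hne (Fin.ext h)
    rcases cases k with ⟨t, ht, e, h, hρ, hh⟩ | ⟨t, ht, e, h, hρ, hh⟩ | ⟨t, ht, e, h, hρ, hh⟩ |
      ⟨t, ht, e, h, hρ, hh⟩ <;>
    rcases cases k' with ⟨t', ht', e', h', hρ', -⟩ | ⟨t', ht', e', h', hρ', -⟩ |
      ⟨t', ht', e', h', hρ', -⟩ | ⟨t', ht', e', h', hρ', -⟩ <;> rw [hh, h', hρ, hρ'] <;>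
    first
    | (right; omega)
    | skip
    all_goals left
    · rw [if_neg]
      intro h
      have := id _ ht' _ ht h
      omega
    · exact if_neg fun h => hdb _ ht _ ht' h.symm
    · exact if_neg fun h => hda _ ht _ ht' h.symm
    · exact if_neg fun h => hdc _ ht _ ht' h.symm
    · exact (hβ _ t ht).2.1 (Or.inr (Or.inr ⟨t', ht', by omega, rfl⟩))
    · exact (hβ _ t ht).2.1 (Or.inr (Or.inl ⟨t', ht', rfl⟩))
    · rw [(hα _ t ht).2.1 (Or.inr ⟨t', ht', by omega, rfl⟩), (hδ _ t ht).1]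
      · simp
      · rintro ⟨i, hi, h⟩
        exact hda i hi t' ht' h
    · exact (hγ _ t ht).2.1 (Or.inr (Or.inr (Or.inl ⟨t', ht', rfl⟩)))
    · exact (hγ _ t ht).2.1 (Or.inr (Or.inl ⟨t', ht', rfl⟩))
    · exact (hγ _ t ht).2.1 (Or.inr (Or.inr (Or.inr ⟨t', ht', by omega, rfl⟩)))

lemma aux_count (n lo hi : ℕ) (h : hi ≤ n) :
    (Finset.univ.filter fun k : Fin n => lo ≤ (k : ℕ) ∧ (k : ℕ) < hi).card = hi - lo := by
  rw [← Nat.card_Ico, ← Finset.card_map Fin.valEmbedding]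
  congr 1
  ext x
  simp only [Finset.mem_map, Finset.mem_filter, Finset.mem_univ, true_and, Fin.valEmbedding_apply,
    Finset.mem_Ico]
  constructor
  · rintro ⟨k, hk, rfl⟩; exact hk
  · intro hx
    exact ⟨⟨x, by omega⟩, hx, rfl⟩

/-- **The columns of `G·diag(p·I_{r0}, I_{r1}, p⁻¹·I_{r2}, I_{n-j})` form a
`ℤ`-basis of `Ω_G`**, with `pΛ ⊆ Ω_G ⊆ p⁻¹Λ`, `dim_{𝔽_p} Λ/(Λ ∩ Ω_G) = r0`
and `dim_{𝔽_p} (Λ + Ω_G)/Λ = r2` (a module annihilated by `p` has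
`𝔽_p`-dimension `r` iff it has `p^r` elements). -/
theorem gp_columns_basis_and_invariant_factors
    (p n j r0 r2 : ℕ) (hp : p.Prime) (hn : 1 ≤ n) (hj1 : 1 ≤ j) (hjn : j ≤ n)
    (hr : r0 + r2 ≤ j) (G : Matrix (Fin n) (Fin n) ℤ) (hG : GPMem p n j r0 r2 G) :
    LinearIndependent ℤ
      (fun k : Fin n => fun i : Fin n => (G i k : ℚ) * DScale p n j r0 r2 k) ∧
    Submodule.span ℤ
      (Set.range fun k : Fin n => fun i : Fin n =>
        (G i k : ℚ) * DScale p n j r0 r2 k) = OmegaQ p n j r0 r2 G ∧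
    (∀ v ∈ intLattice n, (p : ℚ) • v ∈ OmegaQ p n j r0 r2 G) ∧
    (∀ v ∈ OmegaQ p n j r0 r2 G, (p : ℚ) • v ∈ intLattice n) ∧
    Nat.card (↥(intLattice n) ⧸
      ((intLattice n ⊓ OmegaQ p n j r0 r2 G).comap (intLattice n).subtype)) = p ^ r0 ∧
    Nat.card (↥(intLattice n ⊔ OmegaQ p n j r0 r2 G) ⧸
      ((intLattice n).comap (intLattice n ⊔ OmegaQ p n j r0 r2 G).subtype)) = p ^ r2 := by
  have hΛ := aux_G p n j r0 r2 hjn hr G hG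
  obtain ⟨h1, h2, h3, h4, h5⟩ := aux_main p n hp G hΛ (DScale p n j r0 r2)
    (Finset.univ.filter fun k : Fin n => 0 ≤ (k : ℕ) ∧ (k : ℕ) < r0)
    (Finset.univ.filter fun k : Fin n => r0 + (j - r0 - r2) ≤ (k : ℕ) ∧ (k : ℕ) < j)
    (by
      rw [Finset.disjoint_left]
      intro k
      simp only [Finset.mem_filter, Finset.mem_univ, true_and]
      omega)
    (by
      intro k hk
      simp only [Finset.mem_filter, Finset.mem_univ, true_and] at hk
      simp [DScale, hk.2])
    (by
      intro k hk
      simp only [Finset.mem_filter, Finset.mem_univ, true_and] at hk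
      unfold DScale
      rw [if_neg (by omega), if_neg (by omega), if_pos hk.2])
    (by
      intro k hk hk2
      simp only [Finset.mem_filter, Finset.mem_univ, true_and] at hk hk2
      unfold DScale
      rw [if_neg (by omega)]
      split_ifs
      · rfl
      · omega
      · rfl)
    (OmegaQ p n j r0 r2 G) rfl
  rw [aux_count n _ _ (by omega)] at h4 h5
  refine ⟨h1, rfl, h2, h3, ?_, ?_⟩
  · rw [h4]; simp
  · rw [h5]; congr 1; omega
end
end

section
/- Let p be a prime, n ≥ 1, Λ = ℤⁿ regarded as a ℤ-submodule of ℚⁿ, and let Ω be a ℤ-submodule of ℚⁿ with pΛ ⊆ Ω ⊆ p^{-1}Λ. Set r_0 = dim_{𝔽_p} Λ/(Λ ∩ Ω) and r_2 = dim_{𝔽_p} (Λ + Ω)/Λ. Then p(Λ + Ω) ⊆ Λ ∩ Ω and dim_{𝔽_p} (Λ ∩ Ω)/p(Λ + Ω) = n − r_0 − r_2. -/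
noncomputable section
open Matrix Pointwise

/-- The coordinatewise embedding of `ℤⁿ` into `ℚⁿ`. -/
def castHom (n : ℕ) : (Fin n → ℤ) →+ (Fin n → ℚ) where
  toFun v := fun i => (v i : ℚ)
  map_zero' := by ext; simp
  map_add' a b := by ext; simp

/-- Coordinatewise reduction modulo `p`. -/
def redHom (p n : ℕ) : (Fin n → ℤ) →+ (Fin n → ZMod p) where
  toFun v := fun i => (v i : ZMod p)
  map_zero' := by ext; simp
  map_add' a b := by ext; simp

lemma castHom_inj (n : ℕ) : Function.Injective (castHom n) := by
  intro a b h
  ext i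
  have := congrFun h i
  simpa [castHom] using this

lemma mem_intLattice (n : ℕ) (v : Fin n → ℚ) :
    v ∈ intLattice n ↔ ∃ w, castHom n w = v := by
  unfold intLattice
  rw [Submodule.mem_span_range_iff_exists_fun]
  refine exists_congr fun c => ?_
  have : ∑ i, c i • (Pi.single i 1 : Fin n → ℚ) = castHom n c := by
    ext j
    simp [castHom, Finset.sum_apply, Pi.single_apply]
  rw [this]

lemma intLattice_eq (n : ℕ) :
    (intLattice n).toAddSubgroup = (⊤ : AddSubgroup (Fin n → ℤ)).map (castHom n) := by
  ext v
  simp [mem_intLattice]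

lemma smul_intLattice_eq (p n : ℕ) :
    ((p : ℤ) • intLattice n).toAddSubgroup = (redHom p n).ker.map (castHom n) := by
  ext v
  simp only [Submodule.mem_toAddSubgroup, Submodule.mem_smul_pointwise_iff_exists,
    mem_intLattice, AddSubgroup.mem_map, AddMonoidHom.mem_ker]
  constructor
  · rintro ⟨_, ⟨w, rfl⟩, rfl⟩
    refine ⟨(p : ℤ) • w, ?_, by rw [map_zsmul]⟩
    ext i
    simp [redHom]
  · rintro ⟨w, hw, rfl⟩
    have h : ∀ i, ∃ c, w i = (p : ℤ) * c := fun i => by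
      have := congrFun hw i
      exact (ZMod.intCast_zmod_eq_zero_iff_dvd _ _).1 this
    choose c hc using h
    refine ⟨_, ⟨c, rfl⟩, ?_⟩
    rw [← map_zsmul]
    congr 1
    ext i
    simp [hc]

lemma relIndex_intLattice (p n : ℕ) (hp : p.Prime) :
    ((p : ℤ) • intLattice n).toAddSubgroup.relIndex (intLattice n).toAddSubgroup = p ^ n := by
  rw [smul_intLattice_eq, intLattice_eq,
    AddSubgroup.relIndex_map_map_of_injective _ _ (castHom_inj n), AddSubgroup.relIndex_top_right,
    AddSubgroup.index_ker]
  have : (redHom p n).range = ⊤ := by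
    rw [AddMonoidHom.range_eq_top]
    intro v
    choose w hw using fun i => ZMod.intCast_surjective (v i)
    exact ⟨w, funext hw⟩
  rw [this]
  simp [Nat.card_fun]

lemma card_quot_eq {V : Type*} [AddCommGroup V] (A B : Submodule ℤ V) :
    Nat.card (↥A ⧸ (B.comap A.subtype)) = B.toAddSubgroup.relIndex A.toAddSubgroup := rfl

lemma relIndex_smul (p n : ℕ) (hp : p.Prime) (A B : Submodule ℤ (Fin n → ℚ)) :
    ((p : ℤ) • A).toAddSubgroup.relIndex ((p : ℤ) • B).toAddSubgroup =
      A.toAddSubgroup.relIndex B.toAddSubgroup := by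
  have hinj : Function.Injective (zsmulAddGroupHom (p : ℤ) : (Fin n → ℚ) →+ (Fin n → ℚ)) := by
    intro a b h
    have hp0 : (p : ℚ) ≠ 0 := by exact_mod_cast hp.ne_zero
    ext i
    have := congrFun h i
    simpa [hp0] using this
  have key : ∀ C : Submodule ℤ (Fin n → ℚ), ((p : ℤ) • C).toAddSubgroup =
      C.toAddSubgroup.map (zsmulAddGroupHom (p : ℤ) : (Fin n → ℚ) →+ (Fin n → ℚ)) := by
    intro C
    ext v
    simp only [Submodule.mem_toAddSubgroup, Submodule.mem_smul_pointwise_iff_exists,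
      AddSubgroup.mem_map, zsmulAddGroupHom_apply]
  rw [key, key, AddSubgroup.relIndex_map_map_of_injective _ _ hinj]

/-- **`p(Λ + Ω) ⊆ Λ ∩ Ω` and `dim_{𝔽_p} (Λ ∩ Ω)/p(Λ + Ω) = n − r0 − r2`** for
any `ℤ`-submodule `Ω` of `ℚⁿ` with `pΛ ⊆ Ω ⊆ p⁻¹Λ`, where
`r0 = dim_{𝔽_p} Λ/(Λ ∩ Ω)` and `r2 = dim_{𝔽_p} (Λ + Ω)/Λ` (a module
annihilated by `p` has `𝔽_p`-dimension `r` iff it has `p^r` elements). -/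
theorem inf_quot_smul_sup_dim (p n r0 r2 : ℕ) (hp : p.Prime) (hn : 1 ≤ n)
    (Ω : Submodule ℤ (Fin n → ℚ))
    (h1 : ∀ v ∈ intLattice n, (p : ℚ) • v ∈ Ω)
    (h2 : ∀ v ∈ Ω, (p : ℚ) • v ∈ intLattice n)
    (hr0 : Nat.card (↥(intLattice n) ⧸
      ((intLattice n ⊓ Ω).comap (intLattice n).subtype)) = p ^ r0)
    (hr2 : Nat.card (↥(intLattice n ⊔ Ω) ⧸
      ((intLattice n).comap (intLattice n ⊔ Ω).subtype)) = p ^ r2) :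
    (p : ℤ) • (intLattice n ⊔ Ω) ≤ intLattice n ⊓ Ω ∧
    Nat.card (↥(intLattice n ⊓ Ω) ⧸
      (((p : ℤ) • (intLattice n ⊔ Ω)).comap (intLattice n ⊓ Ω).subtype)) =
      p ^ (n - r0 - r2) := by
  have hle : (p : ℤ) • (intLattice n ⊔ Ω) ≤ intLattice n ⊓ Ω := by
    have e : ∀ v : Fin n → ℚ, (p : ℤ) • v = (p : ℚ) • v := fun v => by
      ext i; simp
    intro x hx
    obtain ⟨y, hy, rfl⟩ := (Submodule.mem_smul_pointwise_iff_exists _ _ _).1 hx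
    obtain ⟨a, ha, b, hb, rfl⟩ := Submodule.mem_sup.1 hy
    rw [smul_add]
    refine ⟨add_mem (Submodule.smul_mem _ _ ha) ?_, add_mem ?_ (Submodule.smul_mem _ _ hb)⟩
    · rw [e]; exact h2 b hb
    · rw [e]; exact h1 a ha
  refine ⟨hle, ?_⟩
  rw [card_quot_eq] at hr0 hr2 ⊢
  have hA : ((p : ℤ) • intLattice n).toAddSubgroup ≤
      ((p : ℤ) • (intLattice n ⊔ Ω)).toAddSubgroup :=
    Submodule.map_mono le_sup_left
  have hB : ((p : ℤ) • (intLattice n ⊔ Ω)).toAddSubgroup ≤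
      (intLattice n ⊓ Ω).toAddSubgroup := hle
  have hC : (intLattice n ⊓ Ω).toAddSubgroup ≤ (intLattice n).toAddSubgroup :=
    fun x hx => hx.1
  have t1 := AddSubgroup.relIndex_mul_relIndex _ _ _ hA (hB.trans hC)
  have t2 := AddSubgroup.relIndex_mul_relIndex _ _ _ hB hC
  rw [relIndex_smul p n hp, hr2, relIndex_intLattice p n hp, ← t2, hr0] at t1
  set x := ((p : ℤ) • (intLattice n ⊔ Ω)).toAddSubgroup.relIndex
    (intLattice n ⊓ Ω).toAddSubgroup
  have hd : p ^ (r0 + r2) ∣ p ^ n := ⟨x, by rw [← t1]; ring⟩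
  have hrn : r0 + r2 ≤ n := (Nat.pow_dvd_pow_iff_le_right hp.one_lt).1 hd
  have hpos : 0 < p ^ (r0 + r2) := pow_pos hp.pos _
  apply Nat.eq_of_mul_eq_mul_left hpos
  rw [← pow_add, show r0 + r2 + (n - r0 - r2) = n by omega, ← t1]
  ring
end
end
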